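/- arXiv:2106.11183 — 2 statements merged into one kernel-verified Lean document; each statement's English description precedes it below -/
import Mathlib

section
/- In the doubled frame setting, let d : U → ℝ be smooth and strictly positive on an open set U ⊆ ℝⁿ×ℝⁿ and satisfy the eikonal hypotheses, and let α ∈ ℝ. Then at every point of U: ⟨(D_𝔷²(d^α))² · D_𝔷(d^α), D_𝔷(d^α)⟩ = 8α⁴(α−1)² d^{4α−6}, where (D_𝔷²(d^α))² denotes the matrix square. -/
open Matrix

noncomputable section

/-- Doubled frame on `ℝⁿ × ℝⁿ`: `Z (inl i) (x,y) = (Xᵢ(x), 0)` and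
`Z (inr i) (x,y) = (0, Xᵢ(y))`. -/
def Zf {n : ℕ} (X : Fin n → (Fin n → ℝ) → (Fin n → ℝ)) :
    (Fin n ⊕ Fin n) → (Fin n → ℝ) × (Fin n → ℝ) → (Fin n → ℝ) × (Fin n → ℝ)
  | Sum.inl i, p => (X i p.1, 0)
  | Sum.inr i, p => (0, X i p.2)

/-- Frame gradient `D_𝔷 d` of `d` at `p`, as a vector in `ℝ²ⁿ`. -/
def Dz {n : ℕ} (X : Fin n → (Fin n → ℝ) → (Fin n → ℝ))
    (d : (Fin n → ℝ) × (Fin n → ℝ) → ℝ) (p : (Fin n → ℝ) × (Fin n → ℝ)) :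
    (Fin n ⊕ Fin n) → ℝ :=
  fun i => fderiv ℝ d p (Zf X i p)

/-- Frame second derivative `D²_𝔷 d` of `d` at `p`: the `2n × 2n` matrix with
`(i,j)`-entry `Zᵢ(Zⱼd)(p)`. -/
def Dz2 {n : ℕ} (X : Fin n → (Fin n → ℝ) → (Fin n → ℝ))
    (d : (Fin n → ℝ) × (Fin n → ℝ) → ℝ) (p : (Fin n → ℝ) × (Fin n → ℝ)) :
    Matrix (Fin n ⊕ Fin n) (Fin n ⊕ Fin n) ℝ :=
  fun i j => fderiv ℝ (fun q => fderiv ℝ d q (Zf X j q)) p (Zf X i p)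

/-- Symmetrized frame second derivative `(D²_𝔷 d)* = ½(D²_𝔷 d + (D²_𝔷 d)ᵗ)`. -/
def Dz2Sym {n : ℕ} (X : Fin n → (Fin n → ℝ) → (Fin n → ℝ))
    (d : (Fin n → ℝ) × (Fin n → ℝ) → ℝ) (p : (Fin n → ℝ) × (Fin n → ℝ)) :
    Matrix (Fin n ⊕ Fin n) (Fin n ⊕ Fin n) ℝ :=
  (1 / 2 : ℝ) • (Dz2 X d p + (Dz2 X d p)ᵀ)

/-- The eikonal hypotheses: `Σᵢ₌₁ⁿ (Zᵢd)² = 1` and `Σᵢ₌ₙ₊₁²ⁿ (Zᵢd)² = 1` on `U`. -/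
def EikonalHyp {n : ℕ} (X : Fin n → (Fin n → ℝ) → (Fin n → ℝ))
    (d : (Fin n → ℝ) × (Fin n → ℝ) → ℝ)
    (U : Set ((Fin n → ℝ) × (Fin n → ℝ))) : Prop :=
  ∀ p ∈ U, (∑ i : Fin n, (Dz X d p (Sum.inl i)) ^ 2 = 1) ∧
    (∑ i : Fin n, (Dz X d p (Sum.inr i)) ^ 2 = 1)

/-- Along the frame, the derivative of `d ^ α` is `α d ^ (α - 1)` times that of `d`. -/
theorem Dz_rpow {n : ℕ} (X : Fin n → (Fin n → ℝ) → (Fin n → ℝ))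
    {d : (Fin n → ℝ) × (Fin n → ℝ) → ℝ} {p : (Fin n → ℝ) × (Fin n → ℝ)}
    (hd : DifferentiableAt ℝ d p) (hp : 0 < d p) (α : ℝ) :
    Dz X (fun q => d q ^ α) p = (α * d p ^ (α - 1)) • Dz X d p := by
  have h := (hd.hasFDerivAt.rpow_const (p := α) (Or.inl hp.ne')).fderiv
  funext i
  simp [Dz, h]

theorem differentiable_Zf {n : ℕ} {X : Fin n → (Fin n → ℝ) → (Fin n → ℝ)}
    (hX : ∀ i, Differentiable ℝ (X i)) (i : Fin n ⊕ Fin n) : Differentiable ℝ (Zf X i) := by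
  rcases i with i | i
  · exact ((hX i).comp differentiable_fst).prodMk (differentiable_const 0)
  · exact (differentiable_const 0).prodMk ((hX i).comp differentiable_snd)

/-- The frame Hessian applied to the frame gradient is half the frame gradient of the squared
length of the frame gradient. -/
theorem Dz2_mulVec_Dz {n : ℕ} {X : Fin n → (Fin n → ℝ) → (Fin n → ℝ)}
    (hX : ∀ i, Differentiable ℝ (X i)) {f : (Fin n → ℝ) × (Fin n → ℝ) → ℝ}
    {p : (Fin n → ℝ) × (Fin n → ℝ)} (hf : ContDiffAt ℝ 2 f p) :
    Dz2 X f p *ᵥ Dz X f p = (1 / 2 : ℝ) • Dz X (fun q => Dz X f q ⬝ᵥ Dz X f q) p := by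
  have hf' : DifferentiableAt ℝ (fderiv ℝ f) p :=
    (hf.fderiv_right (m := 1) (by norm_num)).differentiableAt one_ne_zero
  have hw (j) : DifferentiableAt ℝ (fun q => fderiv ℝ f q (Zf X j q)) p :=
    hf'.clm_apply (differentiable_Zf hX j p)
  have hsum := (HasFDerivAt.fun_sum (u := Finset.univ) fun j _ =>
    (hw j).hasFDerivAt.mul (hw j).hasFDerivAt).fderiv
  funext i
  simp only [Pi.smul_apply, smul_eq_mul, mulVec, dotProduct]
  simp only [Dz, Dz2, Pi.mul_apply] at hsum ⊢
  rw [hsum, _root_.sum_apply, Finset.mul_sum]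
  refine Finset.sum_congr rfl fun j _ => ?_
  simp only [_root_.add_apply, _root_.smul_apply, smul_eq_mul]
  ring

/-- In the doubled frame setting, if `d` is smooth and strictly positive on an
open `U ⊆ ℝⁿ×ℝⁿ` and satisfies the eikonal hypotheses, then for any `α ∈ ℝ`, at every
point of `U`, `⟨(D²_𝔷(d^α))² · D_𝔷(d^α), D_𝔷(d^α)⟩ = 8α⁴(α−1)² d^(4α−6)`, where the
square is the matrix square. -/
theorem stmt8 {n : ℕ} (X : Fin n → (Fin n → ℝ) → (Fin n → ℝ))
    (hX : ∀ i, ContDiff ℝ (⊤ : ℕ∞) (X i))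
    (U : Set ((Fin n → ℝ) × (Fin n → ℝ))) (hU : IsOpen U)
    (d : (Fin n → ℝ) × (Fin n → ℝ) → ℝ) (hd : ContDiffOn ℝ (⊤ : ℕ∞) d U)
    (hdpos : ∀ p ∈ U, 0 < d p)
    (heik : EikonalHyp X d U) (α : ℝ) :
    ∀ p ∈ U,
      (Dz2 X (fun q => d q ^ α) p * Dz2 X (fun q => d q ^ α) p).mulVec
          (Dz X (fun q => d q ^ α) p) ⬝ᵥ Dz X (fun q => d q ^ α) p
        = 8 * α ^ 4 * (α - 1) ^ 2 * d p ^ (4 * α - 6) := by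
  intro p hp
  have hdp := hdpos p hp
  have hdiff (q) (hq : q ∈ U) : ContDiffAt ℝ (⊤ : ℕ∞) d q := hd.contDiffAt (hU.mem_nhds hq)
  have hDz (q) (hq : q ∈ U) (β : ℝ) :
      Dz X (fun q => d q ^ β) q = (β * d q ^ (β - 1)) • Dz X d q :=
    Dz_rpow X ((hdiff q hq).differentiableAt (by simp)) (hdpos q hq) β
  have hv (q) (hq : q ∈ U) : Dz X d q ⬝ᵥ Dz X d q = 2 := by
    have h := heik q hq
    simp only [dotProduct, Fintype.sum_sum_type, ← pow_two, h.1, h.2]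
    norm_num
  have hnorm (q) (hq : q ∈ U) : Dz X (fun q => d q ^ α) q ⬝ᵥ Dz X (fun q => d q ^ α) q
      = 2 * α ^ 2 * d q ^ (2 * α - 2) := by
    rw [hDz q hq, smul_dotProduct, dotProduct_smul, hv q hq,
      show 2 * α - 2 = (α - 1) + (α - 1) by ring, Real.rpow_add (hdpos q hq)]
    simp only [smul_eq_mul]
    ring
  have hf : ContDiffAt ℝ 2 (fun q => d q ^ α) p :=
    (contDiffAt_infty.mp (hdiff p hp) 2).rpow_const_of_ne hdp.ne'
  have hgrad : Dz X (fun q => Dz X (fun q => d q ^ α) q ⬝ᵥ Dz X (fun q => d q ^ α) q) p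
      = (2 * α ^ 2) • Dz X (fun q => d q ^ (2 * α - 2)) p := by
    have heq : (fun q => Dz X (fun q => d q ^ α) q ⬝ᵥ Dz X (fun q => d q ^ α) q)
        =ᶠ[nhds p] (2 * α ^ 2) • fun q => d q ^ (2 * α - 2) :=
      Filter.eventually_of_mem (hU.mem_nhds hp) hnorm
    funext i
    simp only [Dz] at heq ⊢
    rw [heq.fderiv_eq, fderiv_const_smul_field]
    rfl
  have heig : Dz2 X (fun q => d q ^ α) p *ᵥ Dz X (fun q => d q ^ α) p
      = (2 * α * (α - 1) * d p ^ (α - 2)) • Dz X (fun q => d q ^ α) p := by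
    rw [Dz2_mulVec_Dz (fun i => (hX i).differentiable (by simp)) hf, hgrad, hDz p hp, hDz p hp,
      smul_smul, smul_smul, smul_smul,
      show 2 * α - 2 - 1 = (α - 2) + (α - 1) by ring, Real.rpow_add hdp]
    congr 1
    ring
  rw [← mulVec_mulVec, heig, mulVec_smul, heig, smul_dotProduct, smul_dotProduct, hnorm p hp,
    show 4 * α - 6 = (α - 2) + (α - 2) + (2 * α - 2) by ring, Real.rpow_add hdp,
    Real.rpow_add hdp]
  simp only [smul_eq_mul]
  ring
end
end

section
/- In the doubled frame setting, let d : U → ℝ be smooth on an open set U ⊆ ℝⁿ×ℝⁿ and satisfy the eikonal hypotheses. Then at every point of U: ⟨((D_𝔷²d)*)² · D_𝔷d, D_𝔷d⟩ = Σᵢ₌₁²ⁿ ( Σₖ₌₁²ⁿ ½(Zᵢ(Zₖd) − Zₖ(Zᵢd)) · Zₖd )². In particular this quantity is nonnegative, and if there is a constant c ≥ 0 with |Zᵢ(Zₖd) − Zₖ(Zᵢd)| ≤ c on U for all i, k, then 0 ≤ ⟨((D_𝔷²d)*)² · D_𝔷d, D_𝔷d⟩ ≤ 2n³c² on U. -/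
open Matrix

noncomputable section

lemma contDiff_Zf {n : ℕ} {X : Fin n → (Fin n → ℝ) → (Fin n → ℝ)}
    (hX : ∀ i, ContDiff ℝ (⊤ : ℕ∞) (X i)) (i : Fin n ⊕ Fin n) :
    ContDiff ℝ (⊤ : ℕ∞) (Zf X i) := by
  rcases i with i | i
  · exact ((hX i).comp contDiff_fst).prodMk contDiff_const
  · exact contDiff_const.prodMk ((hX i).comp contDiff_snd)

lemma differentiableAt_Dz {n : ℕ} {X : Fin n → (Fin n → ℝ) → (Fin n → ℝ)}
    (hX : ∀ i, ContDiff ℝ (⊤ : ℕ∞) (X i)) {d : (Fin n → ℝ) × (Fin n → ℝ) → ℝ}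
    {p : (Fin n → ℝ) × (Fin n → ℝ)} (hd : ContDiffAt ℝ (⊤ : ℕ∞) d p) (i : Fin n ⊕ Fin n) :
    DifferentiableAt ℝ (fun q => Dz X d q i) p := by
  have hfd : ContDiffAt ℝ (⊤ : ℕ∞) (fderiv ℝ d) p := hd.fderiv_right le_rfl
  exact (hfd.differentiableAt (by simp)).clm_apply
    ((contDiff_Zf hX i).differentiable (by simp) p)

lemma EikonalHyp.sum_sq_Dz {n : ℕ} {X : Fin n → (Fin n → ℝ) → (Fin n → ℝ)}
    {d : (Fin n → ℝ) × (Fin n → ℝ) → ℝ} {U : Set ((Fin n → ℝ) × (Fin n → ℝ))}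
    (heik : EikonalHyp X d U) {p : (Fin n → ℝ) × (Fin n → ℝ)} (hp : p ∈ U) :
    ∑ k, Dz X d p k ^ 2 = 2 := by
  rw [Fintype.sum_sum_type, (heik p hp).1, (heik p hp).2]
  norm_num

/-- Differentiating the eikonal equations along the frame: `D²_𝔷 d` annihilates `D_𝔷 d`. -/
lemma EikonalHyp.Dz2_mulVec_Dz {n : ℕ} {X : Fin n → (Fin n → ℝ) → (Fin n → ℝ)}
    (hX : ∀ i, ContDiff ℝ (⊤ : ℕ∞) (X i)) {d : (Fin n → ℝ) × (Fin n → ℝ) → ℝ}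
    {U : Set ((Fin n → ℝ) × (Fin n → ℝ))} (hU : IsOpen U)
    (hd : ContDiffOn ℝ (⊤ : ℕ∞) d U) (heik : EikonalHyp X d U)
    {p : (Fin n → ℝ) × (Fin n → ℝ)} (hp : p ∈ U) :
    Dz2 X d p *ᵥ Dz X d p = 0 := by
  have hUp := hU.mem_nhds hp
  have hsum : HasFDerivAt (fun q => ∑ k, Dz X d q k ^ 2)
      (∑ k, (2 * Dz X d p k) • fderiv ℝ (fun q => Dz X d q k) p) p := by
    refine HasFDerivAt.fun_sum fun k _ => ?_
    simpa using (differentiableAt_Dz hX (hd.contDiffAt hUp) k).hasFDerivAt.pow 2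
  have hconst : HasFDerivAt (fun q => ∑ k, Dz X d q k ^ 2)
      (0 : (Fin n → ℝ) × (Fin n → ℝ) →L[ℝ] ℝ) p :=
    (hasFDerivAt_const (2 : ℝ) p).congr_of_eventuallyEq
      (Filter.mem_of_superset hUp fun _ hq => heik.sum_sq_Dz hq)
  ext i
  have h := DFunLike.congr_fun (hsum.unique hconst) (Zf X i p)
  simp only [_root_.sum_apply, _root_.smul_apply, smul_eq_mul,
    _root_.zero_apply, mul_assoc, ← Finset.mul_sum] at h
  exact (dotProduct_comm (Dz2 X d p i) (Dz X d p)).trans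
    ((mul_eq_zero.mp h).resolve_left two_ne_zero)

/-- If `M v = 0`, the symmetric part of `M` acts on `v` as minus its antisymmetric part. -/
lemma symmPart_sq_mulVec_dotProduct_self {ι : Type*} [Fintype ι] (M : Matrix ι ι ℝ) (v : ι → ℝ)
    (hMv : M *ᵥ v = 0) :
    (((1 / 2 : ℝ) • (M + Mᵀ)) * ((1 / 2 : ℝ) • (M + Mᵀ))) *ᵥ v ⬝ᵥ v =
      ∑ i, (∑ k, (1 / 2 : ℝ) * (M i k - M k i) * v k) ^ 2 := by
  set S := (1 / 2 : ℝ) • (M + Mᵀ) with hS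
  have hST : Sᵀ = S := by
    rw [hS, transpose_smul, transpose_add, transpose_transpose, add_comm]
  have hSv : (S * S) *ᵥ v ⬝ᵥ v = S *ᵥ v ⬝ᵥ S *ᵥ v := by
    rw [← mulVec_mulVec, dotProduct_mulVec, ← mulVec_transpose, hST]
  rw [hSv]
  refine Finset.sum_congr rfl fun i _ => ?_
  have hi : ∑ k, M i k * v k = 0 := congrFun hMv i
  have hneg : (S *ᵥ v) i = -∑ k, (1 / 2 : ℝ) * (M i k - M k i) * v k := by
    rw [eq_neg_iff_add_eq_zero, ← hi]
    simp only [mulVec, dotProduct, ← Finset.sum_add_distrib]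
    refine Finset.sum_congr rfl fun k _ => ?_
    simp only [hS, Matrix.smul_apply, Matrix.add_apply, transpose_apply, smul_eq_mul]
    ring
  rw [hneg]
  ring

lemma sum_sq_half_mul_le {ι : Type*} [Fintype ι] (A : ι → ι → ℝ) (v : ι → ℝ) {c : ℝ}
    (hA : ∀ i k, |A i k| ≤ c) :
    ∑ i, (∑ k, (1 / 2 : ℝ) * A i k * v k) ^ 2 ≤
      (Fintype.card ι * c / 2) ^ 2 * ∑ k, v k ^ 2 := by
  have hrow : ∀ i, (∑ k, (1 / 2 : ℝ) * A i k * v k) ^ 2 ≤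
      Fintype.card ι * (c / 2) ^ 2 * ∑ k, v k ^ 2 := fun i => by
    refine (Finset.sum_mul_sq_le_sq_mul_sq _ _ _).trans ?_
    gcongr
    refine (Finset.sum_le_card_nsmul _ _ ((c / 2) ^ 2) fun k _ => ?_).trans_eq (by simp)
    refine sq_le_sq' ?_ ?_ <;> linarith [abs_le.mp (hA i k)]
  refine (Finset.sum_le_card_nsmul _ _ _ fun i _ => hrow i).trans_eq ?_
  rw [nsmul_eq_mul, Finset.card_univ]
  ring

/-- In the doubled frame setting, if `d` is smooth on an open `U ⊆ ℝⁿ×ℝⁿ` and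
satisfies the eikonal hypotheses, then at every point of `U`
`⟨((D²_𝔷d)*)² · D_𝔷d, D_𝔷d⟩ = Σᵢ (Σₖ ½(Zᵢ(Zₖd) − Zₖ(Zᵢd)) · Zₖd)²`; in particular this
quantity is nonnegative, and if `|Zᵢ(Zₖd) − Zₖ(Zᵢd)| ≤ c` on `U` for all `i, k` (with
`c ≥ 0`), then `0 ≤ ⟨((D²_𝔷d)*)² · D_𝔷d, D_𝔷d⟩ ≤ 2n³c²` on `U`. -/
theorem stmt9 {n : ℕ} (X : Fin n → (Fin n → ℝ) → (Fin n → ℝ))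
    (hX : ∀ i, ContDiff ℝ (⊤ : ℕ∞) (X i))
    (U : Set ((Fin n → ℝ) × (Fin n → ℝ))) (hU : IsOpen U)
    (d : (Fin n → ℝ) × (Fin n → ℝ) → ℝ) (hd : ContDiffOn ℝ (⊤ : ℕ∞) d U)
    (heik : EikonalHyp X d U) :
    (∀ p ∈ U,
      (Dz2Sym X d p * Dz2Sym X d p).mulVec (Dz X d p) ⬝ᵥ Dz X d p =
        ∑ i : Fin n ⊕ Fin n, (∑ k : Fin n ⊕ Fin n,
          (1 / 2 : ℝ) * (Dz2 X d p i k - Dz2 X d p k i) * Dz X d p k) ^ 2) ∧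
    (∀ p ∈ U,
      0 ≤ (Dz2Sym X d p * Dz2Sym X d p).mulVec (Dz X d p) ⬝ᵥ Dz X d p) ∧
    (∀ c : ℝ, 0 ≤ c →
      (∀ p ∈ U, ∀ i k : Fin n ⊕ Fin n, |Dz2 X d p i k - Dz2 X d p k i| ≤ c) →
      ∀ p ∈ U,
        0 ≤ (Dz2Sym X d p * Dz2Sym X d p).mulVec (Dz X d p) ⬝ᵥ Dz X d p ∧
        (Dz2Sym X d p * Dz2Sym X d p).mulVec (Dz X d p) ⬝ᵥ Dz X d p
          ≤ 2 * (n : ℝ) ^ 3 * c ^ 2) := by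
  have key : ∀ p ∈ U, (Dz2Sym X d p * Dz2Sym X d p).mulVec (Dz X d p) ⬝ᵥ Dz X d p =
      ∑ i, (∑ k, (1 / 2 : ℝ) * (Dz2 X d p i k - Dz2 X d p k i) * Dz X d p k) ^ 2 :=
    fun p hp => symmPart_sq_mulVec_dotProduct_self _ _ (heik.Dz2_mulVec_Dz hX hU hd hp)
  have nonneg : ∀ p ∈ U,
      0 ≤ (Dz2Sym X d p * Dz2Sym X d p).mulVec (Dz X d p) ⬝ᵥ Dz X d p := fun p hp => by
    rw [key p hp]
    positivity
  refine ⟨key, nonneg, fun c _ hc p hp => ⟨nonneg p hp, ?_⟩⟩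
  rw [key p hp]
  refine (sum_sq_half_mul_le _ _ (hc p hp)).trans ?_
  rw [heik.sum_sq_Dz hp, Fintype.card_sum, Fintype.card_fin]
  have hn : (n : ℝ) ^ 2 ≤ (n : ℝ) ^ 3 := by
    rcases Nat.eq_zero_or_pos n with rfl | h
    · simp
    · exact_mod_cast Nat.pow_le_pow_right h (by norm_num)
  push_cast
  nlinarith [mul_le_mul_of_nonneg_right hn (sq_nonneg c)]
end
end
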